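/- Let 0 ≤ λ < 1, let σ be a real number, and let c > -1 satisfy −λ < c < 1 − 2λ. If f ∈ A is such that I^σ f is convex of order λ on U (i.e. f ∈ C_σ(λ)), then L_c(I^σ f) is convex of order λ on U (i.e. I^σ f ∈ C_c(λ)). -/

import Mathlib

open Complex MeasureTheory intervalIntegral

noncomputable section

/-- The open unit disk `U = {z : |z| < 1}`. -/
def unitDisk : Set ℂ := Metric.ball 0 1

/-- The class `A` of normalized analytic functions on the unit disk:
`f` analytic on `U`, `f 0 = 0`, `f' 0 = 1`. -/
def memA (f : ℂ → ℂ) : Prop :=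
  DifferentiableOn ℂ f unitDisk ∧ f 0 = 0 ∧ deriv f 0 = 1

/-- The generalized Bernardi–Libera–Livingston integral operator
`(L_c f)(z) = ((c+1)/z^c) ∫₀^z t^{c-1} f t dt`, written after the substitution
`t = s z` as `(c+1) ∫₀¹ s^{c-1} f (s z) ds`. -/
def Lop (c : ℝ) (f : ℂ → ℂ) : ℂ → ℂ := fun z =>
  ((c : ℂ) + 1) * ∫ s in (0:ℝ)..1, ((s ^ (c - 1) : ℝ) : ℂ) * f ((s : ℂ) * z)

/-- The operator `I^σ`, defined via Taylor coefficients: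
`(I^σ f)(z) = z + ∑_{n≥2} (2/(n+1))^σ a_n z^n` where `a_n = f⁽ⁿ⁾(0)/n!`. -/
def Iop (σ : ℝ) (f : ℂ → ℂ) : ℂ → ℂ := fun z =>
  z + ∑' n : ℕ, (((2 / ((n : ℝ) + 3)) ^ σ : ℝ) : ℂ) *
      (iteratedDeriv (n + 2) f 0 / ((n + 2).factorial : ℂ)) * z ^ (n + 2)

/-- Starlike of order `l` : `Re (z f'(z) / f(z)) > l` on `U`. -/
def starlikeOrd (l : ℝ) (f : ℂ → ℂ) : Prop :=
  ∀ z ∈ unitDisk, l < (z * deriv f z / f z).re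

/-- Convex of order `l` : `Re (1 + z f''(z) / f'(z)) > l` on `U`. -/
def convexOrd (l : ℝ) (f : ℂ → ℂ) : Prop :=
  ∀ z ∈ unitDisk, l < (1 + z * deriv (deriv f) z / deriv f z).re

/-- Strongly starlike of order `η` and type `l` :
`|arg (z f'(z)/f(z) - l)| < π η / 2` on `U`. -/
def strongStar (η l : ℝ) (f : ℂ → ℂ) : Prop :=
  ∀ z ∈ unitDisk, |(z * deriv f z / f z - (l : ℂ)).arg| < Real.pi * η / 2

/-- Strongly convex of order `η` and type `l` :
`|arg (1 + z f''(z)/f'(z) - l)| < π η / 2` on `U`. -/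
def strongConv (η l : ℝ) (f : ℂ → ℂ) : Prop :=
  ∀ z ∈ unitDisk, |(1 + z * deriv (deriv f) z / deriv f z - (l : ℂ)).arg| < Real.pi * η / 2

/-- The class `ST_c(η, l)` : `L_c f` strongly starlike and `z (L_c f)'/(L_c f) ≠ l` on `U`. -/
def STc (c η l : ℝ) (f : ℂ → ℂ) : Prop :=
  memA f ∧ strongStar η l (Lop c f) ∧
    ∀ z ∈ unitDisk, z * deriv (Lop c f) z / Lop c f z ≠ (l : ℂ)

/-- The class `CV_c(η, l)` : `L_c f` strongly convex and `(z (L_c f)')'/(L_c f)' ≠ l` on `U`. -/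
def CVc (c η l : ℝ) (f : ℂ → ℂ) : Prop :=
  memA f ∧ strongConv η l (Lop c f) ∧
    ∀ z ∈ unitDisk,
      deriv (fun w => w * deriv (Lop c f) w) z / deriv (Lop c f) z ≠ (l : ℂ)

/-- The class `ST_σ(η, l)` : `I^σ f` strongly starlike and `z (I^σ f)'/(I^σ f) ≠ l` on `U`. -/
def STsigma (σ η l : ℝ) (f : ℂ → ℂ) : Prop :=
  memA f ∧ strongStar η l (Iop σ f) ∧
    ∀ z ∈ unitDisk, z * deriv (Iop σ f) z / Iop σ f z ≠ (l : ℂ)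

/-- The class `CV_σ(η, l)` : `I^σ f` strongly convex and `(z (I^σ f)')'/(I^σ f)' ≠ l` on `U`. -/
def CVsigma (σ η l : ℝ) (f : ℂ → ℂ) : Prop :=
  memA f ∧ strongConv η l (Iop σ f) ∧
    ∀ z ∈ unitDisk,
      deriv (fun w => w * deriv (Iop σ f) w) z / deriv (Iop σ f) z ≠ (l : ℂ)

/-- Membership in `S*(l)`. -/
def inSstar (l : ℝ) (f : ℂ → ℂ) : Prop := memA f ∧ starlikeOrd l f

/-- Membership in `C(l)`. -/
def inC (l : ℝ) (f : ℂ → ℂ) : Prop := memA f ∧ convexOrd l f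

/-- Close-to-convex of order `β` type `l` : there is `g ∈ S*(l)` with
`Re (z f'(z) / g(z)) > β` on `U`. -/
def inK (β l : ℝ) (f : ℂ → ℂ) : Prop :=
  memA f ∧ ∃ g, inSstar l g ∧ ∀ z ∈ unitDisk, β < (z * deriv f z / g z).re

/-- Quasi-convex of order `β` type `l` : there is `g ∈ C(l)` with
`Re ((z f'(z))' / g'(z)) > β` on `U`. -/
def inKstar (β l : ℝ) (f : ℂ → ℂ) : Prop :=
  memA f ∧ ∃ g, inC l g ∧
    ∀ z ∈ unitDisk, β < (deriv (fun w => w * deriv f w) z / deriv g z).re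

end


lemma aux_mem {z : ℂ} : z ∈ unitDisk ↔ ‖z‖ < 1 := by
  simp [unitDisk]

lemma aux_open : IsOpen unitDisk := Metric.isOpen_ball

lemma aux_smul_mem {z : ℂ} (hz : z ∈ unitDisk) {t : ℝ} (h0 : 0 ≤ t) (h1 : t ≤ 1) :
    (t : ℂ) * z ∈ unitDisk := by
  rw [aux_mem] at *
  rw [norm_mul, Complex.norm_real, Real.norm_of_nonneg h0]
  nlinarith [norm_nonneg z]

lemma aux_curve {k : ℂ → ℂ} (hk : DifferentiableOn ℂ k unitDisk) {z : ℂ} {t : ℝ}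
    (hz : (t : ℂ) * z ∈ unitDisk) :
    HasDerivAt (fun s : ℝ => k ((s : ℂ) * z)) (deriv k ((t : ℂ) * z) * z) t := by
  have h1 := (hk.differentiableAt (aux_open.mem_nhds hz)).hasDerivAt
  have h2 : HasDerivAt (fun s : ℂ => s * z) z (t : ℂ) := by
    simpa using (hasDerivAt_id (t : ℂ)).mul_const z
  have h3 : HasDerivAt (fun s : ℂ => k (s * z)) (deriv k ((t : ℂ) * z) * z) (t : ℂ) :=
    HasDerivAt.comp (h := fun s : ℂ => s * z) (h₂ := k) (t : ℂ) h1 h2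
  exact h3.comp_ofReal

/-- nonvanishing of the derivative -/
lemma aux_ne {k : ℂ → ℂ} (hk : DifferentiableOn ℂ k unitDisk) (hk0 : k 0 = 1)
    {lam : ℝ} (hl : 0 ≤ lam)
    (hq : ∀ z ∈ unitDisk, lam < (1 + z * deriv k z / k z).re) :
    ∀ z ∈ unitDisk, k z ≠ 0 := by
  intro z hz hkz
  set φ : ℝ → ℝ := fun t => t ^ 2 * ‖k ((t : ℂ) * z)‖ ^ 2 with hφ
  have hd : ∀ t ∈ Set.Icc (0:ℝ) 1, HasDerivAt φ
      (2 * t * ‖k ((t : ℂ) * z)‖ ^ 2 +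
        t ^ 2 * (2 * inner ℝ (k ((t : ℂ) * z)) (deriv k ((t : ℂ) * z) * z))) t := by
    intro t ht
    have h1 := (aux_curve hk (aux_smul_mem hz ht.1 ht.2)).norm_sq
    have h2 : HasDerivAt (fun t : ℝ => t ^ 2) (2 * t) t := by
      simpa using hasDerivAt_pow 2 t
    exact h2.mul h1
  have hmono : MonotoneOn φ (Set.Icc 0 1) := by
    apply monotoneOn_of_deriv_nonneg (convex_Icc 0 1)
    · intro t ht
      exact (hd t ht).continuousAt.continuousWithinAt
    · intro t ht
      exact (hd t (interior_subset ht)).differentiableAt.differentiableWithinAt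
    · intro t ht
      have ht' := interior_subset ht
      rw [(hd t ht').deriv]
      set y := (t : ℂ) * z with hy
      have hq' := hq y (aux_smul_mem hz ht'.1 ht'.2)
      by_cases hky : k y = 0
      · simp [hky]
      have hpos : 0 < ‖k y‖ ^ 2 := by positivity
      have e : t * inner ℝ (k y) (deriv k y * z) = ‖k y‖ ^ 2 * (y * deriv k y / k y).re := by
        rw [Complex.inner, ← Complex.re_ofReal_mul, ← Complex.re_ofReal_mul]
        congr 1
        push_cast
        rw [← Complex.conj_mul']
        field_simp
        rw [hy]; ring
      have e2 : -1 ≤ (y * deriv k y / k y).re := by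
        simp only [Complex.add_re, Complex.one_re] at hq'
        linarith
      have : 0 ≤ 2 * t * (‖k y‖ ^ 2 + t * inner ℝ (k y) (deriv k y * z)) := by
        have := ht'.1
        rw [e]
        have : 0 ≤ ‖k y‖ ^ 2 + ‖k y‖ ^ 2 * (y * deriv k y / k y).re := by nlinarith
        positivity
      linarith
  have hcont : ContinuousAt (fun t : ℝ => k ((t : ℂ) * z)) 0 :=
    (aux_curve hk (t := 0) (z := z) (by simp [aux_mem])).continuousAt
  have hne : ∀ᶠ t : ℝ in nhds 0, k ((t : ℂ) * z) ≠ 0 :=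
    hcont.eventually_ne (by simp [hk0])
  have hne' : ∀ᶠ t : ℝ in nhdsWithin 0 (Set.Ioi 0), k ((t : ℂ) * z) ≠ 0 ∧ t ∈ Set.Ioo (0:ℝ) 1 :=
    (hne.filter_mono nhdsWithin_le_nhds).and (Ioo_mem_nhdsGT one_pos)
  obtain ⟨t, ht, ht0, ht1⟩ := hne'.exists
  have := hmono ⟨ht0.le, ht1.le⟩ ⟨zero_le_one, le_rfl⟩ ht1.le
  simp only [hφ, Complex.ofReal_one, one_mul, hkz] at this
  have h2 : 0 < t ^ 2 * ‖k ((t : ℂ) * z)‖ ^ 2 := by positivity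
  simp at this
  linarith

/-- Jack's lemma -/
lemma aux_jack {v : ℂ → ℂ} (hv : DifferentiableOn ℂ v unitDisk) {z : ℂ} (hz : z ∈ unitDisk)
    (hmax : ∀ y, ‖y‖ ≤ ‖z‖ → ‖v y‖ ≤ ‖v z‖) :
    0 ≤ ((starRingEnd ℂ) (v z) * (z * deriv v z)).re ∧
    ((starRingEnd ℂ) (v z) * (z * deriv v z)).im = 0 := by
  have hva := (hv.differentiableAt (aux_open.mem_nhds hz)).hasDerivAt
  constructor
  · have h1 := (aux_curve hv (t := 1) (z := z) (by simpa using hz)).norm_sq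
    simp only [Complex.ofReal_one, one_mul, Complex.inner] at h1
    have hm : IsLocalMaxOn (fun s : ℝ => ‖v ((s : ℂ) * z)‖ ^ 2) (Set.Icc 0 1) 1 := by
      filter_upwards [self_mem_nhdsWithin] with s hs
      have := hmax ((s : ℂ) * z) (by
        rw [norm_mul, Complex.norm_real, Real.norm_of_nonneg hs.1]
        nlinarith [norm_nonneg z, hs.2])
      simp only [Complex.ofReal_one, one_mul]
      gcongr
    have := hm.hasFDerivWithinAt_nonpos h1.hasFDerivAt.hasFDerivWithinAt (y := -1)
      (mem_posTangentConeAt_of_segment_subset (by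
        rw [segment_eq_Icc']; intro x hx; simp at hx ⊢; exact hx))
    simp at this
    simp only [Complex.mul_re, Complex.mul_im, Complex.conj_re, Complex.conj_im] at this ⊢
    nlinarith
  · have h2 : HasDerivAt (fun s : ℂ => Complex.exp (s * I) * z) (I * z) ((0 : ℝ) : ℂ) := by
      have := (((hasDerivAt_id ((0 : ℝ) : ℂ)).mul_const I).cexp).mul_const z
      simpa using this
    have h3 : HasDerivAt (fun s : ℂ => v (Complex.exp (s * I) * z)) (deriv v z * (I * z))
        ((0 : ℝ) : ℂ) :=
      HasDerivAt.comp (h := fun s : ℂ => Complex.exp (s * I) * z) (h₂ := v) ((0 : ℝ) : ℂ)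
        (by simpa using hva) h2
    have h4 := h3.comp_ofReal.norm_sq
    have hm : IsLocalMax (fun s : ℝ => ‖v (Complex.exp ((s : ℂ) * I) * z)‖ ^ 2) 0 := by
      refine Filter.Eventually.of_forall fun s => ?_
      have := hmax (Complex.exp ((s : ℂ) * I) * z) (by
        rw [norm_mul, Complex.norm_exp_ofReal_mul_I, one_mul])
      simp only [Complex.ofReal_zero, zero_mul, Complex.exp_zero, one_mul]
      gcongr
    have := hm.hasDerivAt_eq_zero h4
    simp [Complex.inner] at this
    simp only [Complex.mul_re, Complex.mul_im, Complex.conj_re, Complex.conj_im] at this ⊢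
    linarith

/-- The key estimate. -/
lemma aux_key {w Q : ℂ → ℂ} (hw : DifferentiableOn ℂ w unitDisk) {a C : ℝ} (ha : 0 < a)
    (hC : 0 < C) (hQ : ∀ z ∈ unitDisk, a < (Q z).re)
    (hode : ∀ z ∈ unitDisk, z * deriv w z + w z * Q z = C) :
    ∀ z ∈ unitDisk, ‖w z - ((C / (2 * a) : ℝ) : ℂ)‖ < C / (2 * a) := by
  intro z1 hz1
  by_contra! hcon
  set R : ℝ := C / (2 * a) with hR
  have hRpos : 0 < R := by positivity
  have hRa : 2 * a * R = C := by rw [hR]; field_simp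
  set v : ℂ → ℂ := fun z => w z - (R : ℂ) with hvdef
  have hv : DifferentiableOn ℂ v unitDisk := hw.sub_const _
  have hsub : Metric.closedBall (0:ℂ) ‖z1‖ ⊆ unitDisk := by
    intro y hy
    rw [aux_mem] at *
    simp at hy
    linarith
  obtain ⟨z, hz, hzmax⟩ := (isCompact_closedBall (0:ℂ) ‖z1‖).exists_isMaxOn
    ⟨z1, by simp⟩ ((hv.continuousOn.mono hsub).norm)
  have hzU := hsub hz
  have hz' : ‖z‖ ≤ ‖z1‖ := by simpa using hz
  have hge : R ≤ ‖v z‖ := hcon.trans (hzmax (by simp : z1 ∈ Metric.closedBall (0:ℂ) ‖z1‖))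
  obtain ⟨hre, him⟩ := aux_jack hv hzU (fun y hy => hzmax (by simpa using hy.trans hz'))
  have hdv : deriv v z = deriv w z := by simp [hvdef]
  have ho := hode z hzU
  have hq := hQ z hzU
  rw [hdv, show z * deriv w z = C - w z * Q z by rw [← ho]; ring] at hre him
  have hge2 : R ^ 2 ≤ ‖v z‖ ^ 2 := by gcongr
  rw [← Complex.normSq_eq_norm_sq, Complex.normSq_apply] at hge2
  simp only [hvdef, Complex.mul_re, Complex.mul_im, Complex.conj_re, Complex.conj_im,
    Complex.sub_re, Complex.sub_im, Complex.ofReal_re, Complex.ofReal_im] at hre him hge2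
  generalize (w z).re = x at *
  generalize (w z).im = y at *
  generalize (Q z).re = p at *
  generalize (Q z).im = q at *
  clear_value R
  have hxy : 0 < x ^ 2 + y ^ 2 := by
    by_contra! h
    have hx : x = 0 := by nlinarith [sq_nonneg x, sq_nonneg y]
    have hy : y = 0 := by nlinarith [sq_nonneg x, sq_nonneg y]
    subst hx; subst hy
    nlinarith [mul_pos hRpos hC]
  have hn : 2 * R * x ≤ x ^ 2 + y ^ 2 := by nlinarith
  have hV : 0 < (x - R) ^ 2 + y ^ 2 := by nlinarith [sq_pos_of_pos hRpos]
  obtain ⟨M, hM⟩ : ∃ M, M = (x - R) * (C - (x * p - y * q)) - -(y - 0) * (0 - (x * q + y * p)) :=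
    ⟨_, rfl⟩
  rw [← hM] at hre
  have e1 : p * ((x ^ 2 + y ^ 2) * ((x - R) ^ 2 + y ^ 2)) =
      C * x * ((x - R) ^ 2 + y ^ 2) - M * (x ^ 2 + y ^ 2 - R * x) := by
    rw [hM]
    linear_combination (R * y) * him
  have e2 : C * x ≤ a * (x ^ 2 + y ^ 2) := by rw [← hRa]; nlinarith
  have e3 : 0 ≤ M * (x ^ 2 + y ^ 2 - R * x) := mul_nonneg hre (by nlinarith)
  have e4 := mul_le_mul_of_nonneg_right e2 hV.le
  have e5 := mul_lt_mul_of_pos_right hq (mul_pos hxy hV)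
  nlinarith

lemma aux_coef (σ : ℝ) : ∃ K : ℕ, ∀ n : ℕ,
    (2 / ((n : ℝ) + 3)) ^ σ ≤ (((n + 3 : ℕ) : ℝ)) ^ K := by
  obtain ⟨K, hK⟩ := exists_nat_ge (-σ)
  refine ⟨K, fun n => ?_⟩
  have hn : (0:ℝ) ≤ n := n.cast_nonneg
  have h3 : (0:ℝ) < (n:ℝ) + 3 := by positivity
  calc (2 / ((n : ℝ) + 3)) ^ σ ≤ (2 / ((n : ℝ) + 3)) ^ (-(K : ℝ)) := by
        apply Real.rpow_le_rpow_of_exponent_ge (by positivity)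
        · rw [div_le_one h3]; linarith
        · linarith
    _ = (((n : ℝ) + 3) / 2) ^ K := by
        rw [Real.rpow_neg (by positivity), Real.rpow_natCast, ← inv_pow, inv_div]
    _ ≤ (((n + 3 : ℕ) : ℝ)) ^ K := by
        push_cast
        gcongr
        linarith

lemma aux_summ (σ : ℝ) {f : ℂ → ℂ} (hf : DifferentiableOn ℂ f unitDisk) {ρ : ℝ} (h0 : 0 < ρ)
    (h1 : ρ < 1) :
    Summable (fun n : ℕ => ‖(((2 / ((n : ℝ) + 3)) ^ σ : ℝ) : ℂ) *
      (iteratedDeriv (n + 2) f 0 / ((n + 2).factorial : ℂ))‖ * ρ ^ (n + 2)) := by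
  obtain ⟨r, hr0, hr1⟩ := exists_between h1
  have hrpos : 0 < r := h0.trans hr0
  have hs := (Complex.hasSum_taylorSeries_on_ball (c := 0) (r := 1) (f := f) (z := (r : ℂ))
    (by simpa [unitDisk] using hf)
    (by simp [abs_of_pos hrpos, hr1])).summable.tendsto_atTop_zero
  obtain ⟨M, hM⟩ := hs.norm.bddAbove_range
  have hM' : ∀ n, ‖iteratedDeriv n f 0 / (n.factorial : ℂ)‖ * r ^ n ≤ M := by
    intro n
    have := hM ⟨n, rfl⟩
    simp only [sub_zero, smul_eq_mul, norm_mul, norm_inv, norm_pow, Complex.norm_real,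
      Real.norm_of_nonneg hrpos.le] at this
    rw [norm_div]
    calc _ = _ := by ring
      _ ≤ M := this
  obtain ⟨K, hK⟩ := aux_coef σ
  have hq : ρ / r < 1 := (div_lt_one hrpos).2 hr0
  have hq0 : 0 < ρ / r := by positivity
  have hsum := summable_pow_mul_geometric_of_norm_lt_one K (r := ρ / r)
    (by rw [Real.norm_of_nonneg hq0.le]; exact hq)
  have hsum2 := (((summable_nat_add_iff 3).2 hsum).mul_left (M * (ρ / r)⁻¹))
  refine Summable.of_nonneg_of_le (fun n => by positivity) (fun n => ?_) hsum2
  have hM0 := hM' (n + 2)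
  have hMn : 0 ≤ M := le_trans (by positivity) hM0
  rw [norm_mul, Complex.norm_real, Real.norm_of_nonneg (by positivity)]
  have e : ρ ^ (n + 2) = r ^ (n + 2) * (ρ / r) ^ (n + 2) := by
    rw [← mul_pow, mul_div_cancel₀ _ hrpos.ne']
  calc _ = (2 / ((n : ℝ) + 3)) ^ σ *
        (‖iteratedDeriv (n + 2) f 0 / ((n + 2).factorial : ℂ)‖ * r ^ (n + 2))
          * (ρ / r) ^ (n + 2) := by rw [e]; ring
    _ ≤ (((n + 3 : ℕ) : ℝ)) ^ K * M * (ρ / r) ^ (n + 2) := by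
        gcongr
        exact hK n
    _ = M * (ρ / r)⁻¹ * ((((n + 3 : ℕ) : ℝ)) ^ K * (ρ / r) ^ (n + 3)) := by
        rw [pow_succ (ρ / r) (n + 2)]
        field_simp

lemma aux_Iop (σ : ℝ) {f : ℂ → ℂ} (hf : memA f) : memA (Iop σ f) := by
  have key : ∀ ρ : ℝ, 0 < ρ → ρ < 1 → ∀ (n : ℕ) (w : ℂ), w ∈ Metric.ball (0:ℂ) ρ →
      ‖(((2 / ((n : ℝ) + 3)) ^ σ : ℝ) : ℂ) *
      (iteratedDeriv (n + 2) f 0 / ((n + 2).factorial : ℂ)) * w ^ (n + 2)‖ ≤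
      ‖(((2 / ((n : ℝ) + 3)) ^ σ : ℝ) : ℂ) *
      (iteratedDeriv (n + 2) f 0 / ((n + 2).factorial : ℂ))‖ * ρ ^ (n + 2) := by
    intro ρ h0 h1 n w hw
    rw [norm_mul, norm_pow]
    have : ‖w‖ ≤ ρ := by simpa using (Metric.ball_subset_closedBall hw)
    gcongr
  have hd : ∀ ρ : ℝ, 0 < ρ → ρ < 1 → DifferentiableOn ℂ (fun z : ℂ =>
      ∑' n : ℕ, (((2 / ((n : ℝ) + 3)) ^ σ : ℝ) : ℂ) *
      (iteratedDeriv (n + 2) f 0 / ((n + 2).factorial : ℂ)) * z ^ (n + 2)) (Metric.ball 0 ρ) := by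
    intro ρ h0 h1
    exact differentiableOn_tsum_of_summable_norm (aux_summ σ hf.1 h0 h1)
      (fun n => by fun_prop) Metric.isOpen_ball (key ρ h0 h1)
  refine ⟨?_, ?_, ?_⟩
  · intro z hz
    obtain ⟨ρ, h0, h1⟩ := exists_between (aux_mem.1 hz)
    have := hd ρ ((norm_nonneg z).trans_lt h0) h1
    exact (differentiableAt_id.add (this.differentiableAt
      (Metric.isOpen_ball.mem_nhds (by simpa using h0)))).differentiableWithinAt
  · simp [Iop]
  · have h := hasSum_deriv_of_summable_norm (z := 0)
      (aux_summ σ hf.1 (ρ := 1 / 2) (by norm_num) (by norm_num))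
      (fun n => by fun_prop) Metric.isOpen_ball (key (1 / 2) (by norm_num) (by norm_num))
      (Metric.mem_ball_self (by norm_num))
    have hz : ∀ n : ℕ, deriv (fun z : ℂ => (((2 / ((n : ℝ) + 3)) ^ σ : ℝ) : ℂ) *
        (iteratedDeriv (n + 2) f 0 / ((n + 2).factorial : ℂ)) * z ^ (n + 2)) 0 = 0 := by
      intro n
      rw [((hasDerivAt_pow (n + 2) (0:ℂ)).const_mul _).deriv]
      simp
    simp only [hz] at h
    have h' := h.unique hasSum_zero
    have h2 := (hd (1 / 2) (by norm_num) (by norm_num)).differentiableAt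
      (x := 0) (Metric.isOpen_ball.mem_nhds (by simp))
    have h3 := (hasDerivAt_id (0:ℂ)).add h2.hasDerivAt
    rw [h', add_zero] at h3
    exact h3.deriv

lemma aux_cont {G : ℂ → ℂ} (hG : ContinuousOn G unitDisk) {z : ℂ} (hz : z ∈ unitDisk) :
    ContinuousOn (fun s : ℝ => G ((s : ℂ) * z)) (Set.Icc 0 1) := by
  refine hG.comp (by fun_prop) ?_
  intro s hs
  exact aux_smul_mem hz hs.1 hs.2

lemma aux_int {G : ℂ → ℂ} (hG : ContinuousOn G unitDisk) {z : ℂ} (hz : z ∈ unitDisk)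
    {c : ℝ} (hc : -1 < c) :
    IntervalIntegrable (fun s : ℝ => ((s ^ c : ℝ) : ℂ) * G ((s : ℂ) * z)) volume 0 1 := by
  have h1 : IntervalIntegrable (fun s : ℝ => ((s ^ c : ℝ) : ℂ)) volume 0 1 :=
    have h := intervalIntegrable_rpow' (a := 0) (b := 1) hc
    ⟨h.1.ofReal, h.2.ofReal⟩
  apply h1.mul_continuousOn
  rw [Set.uIcc_of_le zero_le_one]
  exact aux_cont hG hz

/-- differentiation under the integral, and the ODE -/
lemma aux_J {G : ℂ → ℂ} (hG : DifferentiableOn ℂ G unitDisk) {c : ℝ} (hc : -1 < c)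
    {z : ℂ} (hz : z ∈ unitDisk) :
    ∃ J' : ℂ, HasDerivAt (fun z => ∫ s in (0:ℝ)..1, ((s ^ c : ℝ) : ℂ) * G ((s : ℂ) * z)) J' z ∧
      z * J' + (c + 1) * (∫ s in (0:ℝ)..1, ((s ^ c : ℝ) : ℂ) * G ((s : ℂ) * z)) = G z := by
  have hG' : DifferentiableOn ℂ (deriv G) unitDisk := hG.deriv aux_open
  obtain ⟨ρ, h0, h1⟩ := exists_between (aux_mem.1 hz)
  have hsub : Metric.closedBall (0:ℂ) ρ ⊆ unitDisk := by
    intro y hy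
    rw [aux_mem]
    simp at hy
    linarith
  obtain ⟨M, hM⟩ := (isCompact_closedBall (0:ℂ) ρ).exists_bound_of_continuousOn
    (hG'.continuousOn.mono hsub)
  have hcont1 : ∀ s : ℝ, 0 < s → s ≤ 1 → ∀ x ∈ Metric.ball (0:ℂ) ρ,
      (s : ℂ) * x ∈ Metric.closedBall (0:ℂ) ρ := by
    intro s hs0 hs1 x hx
    simp at hx ⊢
    rw [abs_of_pos hs0]
    nlinarith [norm_nonneg x]
  have hint' := aux_int hG'.continuousOn hz (c := c + 1) (by linarith)
  have hint := aux_int hG.continuousOn hz hc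
  have hmem : Metric.ball (0:ℂ) ρ ∈ nhds z := Metric.isOpen_ball.mem_nhds (by simpa using h0)
  have hD := intervalIntegral.hasDerivAt_integral_of_dominated_loc_of_deriv_le
    (μ := volume) (a := 0) (b := 1) (bound := fun s : ℝ => s ^ (c + 1) * M)
    (F := fun (z : ℂ) (s : ℝ) => ((s ^ c : ℝ) : ℂ) * G ((s : ℂ) * z))
    (F' := fun (z : ℂ) (s : ℝ) => ((s ^ (c + 1) : ℝ) : ℂ) * deriv G ((s : ℂ) * z)) hmem
    (by
      filter_upwards [hmem] with x hx
      have := aux_int hG.continuousOn (hsub (Metric.ball_subset_closedBall hx)) hc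
      rw [intervalIntegrable_iff] at this
      exact this.aestronglyMeasurable)
    hint
    (by
      rw [intervalIntegrable_iff] at hint'
      exact hint'.aestronglyMeasurable)
    (by
      refine Filter.Eventually.of_forall fun s hs x hx => ?_
      rw [Set.uIoc_of_le zero_le_one] at hs
      have hp : 0 ≤ s ^ (c + 1) := Real.rpow_nonneg hs.1.le _
      rw [norm_mul, Complex.norm_real, Real.norm_of_nonneg hp]
      have := hM _ (hcont1 s hs.1 hs.2 x hx)
      gcongr)
    ((intervalIntegrable_rpow' (by linarith)).mul_const M)
    (by
      refine Filter.Eventually.of_forall fun s hs x hx => ?_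
      rw [Set.uIoc_of_le zero_le_one] at hs
      have h1 := (hG.differentiableAt (aux_open.mem_nhds
        (hsub (hcont1 s hs.1 hs.2 x hx)))).hasDerivAt
      have h2 : HasDerivAt (fun y : ℂ => (s : ℂ) * y) (s : ℂ) x := by
        simpa using (hasDerivAt_id x).const_mul (s : ℂ)
      have h3 := (HasDerivAt.comp (h := fun y : ℂ => (s : ℂ) * y) (h₂ := G) x h1 h2).const_mul
        ((s ^ c : ℝ) : ℂ)
      refine h3.congr_deriv ?_
      rw [Real.rpow_add_one hs.1.ne']
      push_cast
      ring)
  refine ⟨_, hD.2, ?_⟩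
  have hftc := intervalIntegral.integral_eq_sub_of_hasDerivAt_of_le (a := 0) (b := 1)
    (f := fun s : ℝ => ((s ^ (c + 1) : ℝ) : ℂ) * G ((s : ℂ) * z))
    (f' := fun s : ℝ => z * (((s ^ (c + 1) : ℝ) : ℂ) * deriv G ((s : ℂ) * z)) +
      (c + 1) * (((s ^ c : ℝ) : ℂ) * G ((s : ℂ) * z))) zero_le_one
    (by
      refine ContinuousOn.mul ?_ (aux_cont hG.continuousOn hz)
      refine Complex.continuous_ofReal.comp_continuousOn ?_
      exact (Real.continuous_rpow_const (by linarith)).continuousOn)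
    (by
      intro s hs
      have h1 := aux_curve hG (aux_smul_mem hz hs.1.le hs.2.le)
      have h2 := (Real.hasDerivAt_rpow_const (x := s) (p := c + 1) (Or.inl hs.1.ne')).ofReal_comp
      refine (h2.mul h1).congr_deriv ?_
      rw [add_sub_cancel_right]
      push_cast
      ring)
    ((hint'.const_mul z).add (hint.const_mul _))
  rw [intervalIntegral.integral_add (hint'.const_mul z) (hint.const_mul _),
    intervalIntegral.integral_const_mul, intervalIntegral.integral_const_mul] at hftc
  rw [hftc]
  simp [Real.zero_rpow (by linarith : c + 1 ≠ 0)]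

lemma aux_Lop {g : ℂ → ℂ} (hg : DifferentiableOn ℂ g unitDisk) (hg0 : g 0 = 0) {c : ℝ}
    (hc : -1 < c) :
    DifferentiableOn ℂ (Lop c g) unitDisk ∧
    ∀ z ∈ unitDisk, z * deriv (Lop c g) z + c * Lop c g z = (c + 1) * g z := by
  set G := dslope g 0 with hGdef
  have hG : DifferentiableOn ℂ G unitDisk :=
    (Complex.differentiableOn_dslope (aux_open.mem_nhds (by simp [aux_mem]))).2 hg
  have hgG : ∀ z, g z = z * G z := by
    intro z
    have := sub_smul_dslope g 0 z
    simpa [hg0] using this.symm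
  have hL : Lop c g = fun z => (c + 1) * (z *
      ∫ s in (0:ℝ)..1, ((s ^ c : ℝ) : ℂ) * G ((s : ℂ) * z)) := by
    funext z
    rw [Lop]
    congr 1
    rw [← intervalIntegral.integral_const_mul]
    apply intervalIntegral.integral_congr_ae
    refine Filter.Eventually.of_forall fun s hs => ?_
    rw [Set.uIoc_of_le zero_le_one] at hs
    have e : s ^ c = s ^ (c - 1) * s := by
      rw [← Real.rpow_add_one hs.1.ne', sub_add_cancel]
    rw [hgG, e]
    push_cast
    ring
  have hder : ∀ z ∈ unitDisk, ∃ J' : ℂ, HasDerivAt (Lop c g) ((c + 1) *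
      ((∫ s in (0:ℝ)..1, ((s ^ c : ℝ) : ℂ) * G ((s : ℂ) * z)) + z * J')) z ∧
      z * J' + (c + 1) * (∫ s in (0:ℝ)..1, ((s ^ c : ℝ) : ℂ) * G ((s : ℂ) * z)) = G z := by
    intro z hz
    obtain ⟨J', h1, h2⟩ := aux_J hG hc hz
    refine ⟨J', ?_, h2⟩
    rw [hL]
    have := ((hasDerivAt_id z).mul h1).const_mul ((c : ℂ) + 1)
    simpa using this
  refine ⟨fun z hz => ?_, fun z hz => ?_⟩
  · obtain ⟨J', h1, h2⟩ := hder z hz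
    exact h1.differentiableAt.differentiableWithinAt
  · obtain ⟨J', h1, h2⟩ := hder z hz
    rw [h1.deriv, hgG, ← h2, hL]
    ring

theorem Iop_convex_implies_Lop_Iop_convex
    (c lam σ : ℝ) (hc : -1 < c) (hlam0 : 0 ≤ lam) (hlam1 : lam < 1)
    (hlow : -lam < c) (hhigh : c < 1 - 2 * lam)
    (f : ℂ → ℂ) (hf : memA f) (hconv : convexOrd lam (Iop σ f)) :
    convexOrd lam (Lop c (Iop σ f)) := by
  obtain ⟨hg, hg0, hg1⟩ := aux_Iop σ hf
  generalize Iop σ f = g at *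
  obtain ⟨hF, hFode⟩ := aux_Lop hg hg0 hc
  generalize Lop c g = F at *
  have hk := hg.deriv aux_open
  have hh := hF.deriv aux_open
  have hkne := aux_ne hk hg1 hlam0 hconv
  have hode1 : ∀ z ∈ unitDisk, z * deriv (deriv F) z + (c + 1) * deriv F z =
      (c + 1) * deriv g z := by
    intro z hz
    have hn := aux_open.mem_nhds hz
    have d1 := ((hasDerivAt_id z).mul (hh.differentiableAt hn).hasDerivAt).add
      ((hF.differentiableAt hn).hasDerivAt.const_mul (c : ℂ))
    have d2 := (hg.differentiableAt hn).hasDerivAt.const_mul ((c : ℂ) + 1)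
    have heq : (fun z => z * deriv F z + c * F z) =ᶠ[nhds z] fun z => (c + 1) * g z := by
      filter_upwards [hn] with y hy using hFode y hy
    have := (d2.congr_of_eventuallyEq heq).unique d1
    simp at this
    linear_combination -this
  have hw : DifferentiableOn ℂ (fun z => deriv F z / deriv g z) unitDisk := hh.div hk hkne
  have ha : 0 < lam + c := by linarith
  have hC : 0 < c + 1 := by linarith
  have key := aux_key hw ha hC
    (Q := fun z => 1 + z * deriv (deriv g) z / deriv g z + c)
    (fun z hz => by
      have := hconv z hz
      rw [Complex.add_re, Complex.ofReal_re]
      linarith)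
    (fun z hz => by
      have hn := aux_open.mem_nhds hz
      have hne := hkne z hz
      rw [((hh.differentiableAt hn).hasDerivAt.fun_div (hk.differentiableAt hn).hasDerivAt
        hne).deriv]
      have := hode1 z hz
      push_cast
      field_simp
      linear_combination (deriv g z) * this)
  intro z hz
  have hz' := key z hz
  have hne := hkne z hz
  have ho := hode1 z hz
  have hw0 : deriv F z ≠ 0 := by
    intro h
    rw [h, zero_div, zero_sub, norm_neg, Complex.norm_real,
      Real.norm_of_nonneg (by positivity)] at hz'
    exact lt_irrefl _ hz'
  have e : 1 + z * deriv (deriv F) z / deriv F z =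
      ((c + 1 : ℝ) : ℂ) * (deriv F z / deriv g z)⁻¹ - c := by
    push_cast
    field_simp
    linear_combination ho
  have hW : deriv F z / deriv g z ≠ 0 := div_ne_zero hw0 hne
  rw [e]
  generalize deriv F z / deriv g z = W at *
  rw [Complex.sub_re, Complex.re_ofReal_mul, Complex.ofReal_re, Complex.inv_re]
  have hn : 0 < Complex.normSq W := Complex.normSq_pos.2 hW
  have h2 : ‖W - (((c + 1) / (2 * (lam + c)) : ℝ) : ℂ)‖ ^ 2 < ((c + 1) / (2 * (lam + c))) ^ 2 := by
    gcongr
  rw [← Complex.normSq_eq_norm_sq, Complex.normSq_apply] at h2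
  obtain ⟨R, hR⟩ : ∃ R, R = (c + 1) / (2 * (lam + c)) := ⟨_, rfl⟩
  rw [← hR] at h2
  have hRa : 2 * (lam + c) * R = c + 1 := by rw [hR]; field_simp
  simp only [Complex.sub_re, Complex.sub_im, Complex.ofReal_re, Complex.ofReal_im] at h2
  have h3 : Complex.normSq W < 2 * R * W.re := by
    rw [Complex.normSq_apply]; nlinarith
  have h4 : lam + c < (c + 1) * (W.re / Complex.normSq W) := by
    rw [← mul_div_assoc, lt_div_iff₀ hn, ← hRa]
    nlinarith
  linarith
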